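/- Let N ≥ 1 be an integer and a > 0. Set ν̃_m := (2m−1)π/(2a) for 1 ≤ m ≤ N, and define the N×N complex matrix A by A_{nm} := (−1)^{n+m}·ν̃_m^{2(n−1)} for 1 ≤ n,m ≤ N. Then A is invertible and ‖A^{−1}‖_∞ ≤ e^a / a, where ‖·‖_∞ denotes the matrix operator norm induced by the maximum norm (the maximum absolute row sum). -/

import Mathlib

open Real Matrix
open scoped Real

noncomputable section

section

open scoped Nat

/-- The sum of the absolute values of the coefficients of a product of linear factors. -/
theorem Polynomial.sum_abs_coeff_prod_linear_le {ι : Type*} (s : Finset ι) (u x : ι → ℝ) (M : ℕ) :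
    ∑ i ∈ Finset.range M,
      |(∏ k ∈ s, (Polynomial.C (u k) * (Polynomial.X - Polynomial.C (x k)))).coeff i| ≤
      ∏ k ∈ s, |u k| * (1 + |x k|) := by
  classical
  induction s using Finset.induction_on generalizing M with
  | empty =>
    simp only [Finset.prod_empty, Polynomial.coeff_one]
    calc ∑ i ∈ Finset.range M, |if i = 0 then (1 : ℝ) else 0|
        = ∑ i ∈ Finset.range M, if i = 0 then (1 : ℝ) else 0 :=
          Finset.sum_congr rfl fun i _ => by split_ifs <;> simp
      _ ≤ 1 := by
          rw [Finset.sum_ite_eq']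
          split_ifs <;> norm_num
  | insert k s hk ih =>
    rw [Finset.prod_insert hk, Finset.prod_insert hk]
    set q := ∏ k ∈ s, (Polynomial.C (u k) * (Polynomial.X - Polynomial.C (x k)))
    have hshift : ∑ i ∈ Finset.range M, |(Polynomial.X * q).coeff i| ≤
        ∏ k ∈ s, |u k| * (1 + |x k|) := by
      cases M with
      | zero => simpa using ih 0
      | succ M =>
        rw [Finset.sum_range_succ']
        simpa using ih M
    calc ∑ i ∈ Finset.range M,
          |(Polynomial.C (u k) * (Polynomial.X - Polynomial.C (x k)) * q).coeff i|
        ≤ ∑ i ∈ Finset.range M, |u k| * (|(Polynomial.X * q).coeff i| + |x k| * |q.coeff i|) := by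
          refine Finset.sum_le_sum fun i _ => ?_
          rw [mul_assoc, sub_mul, Polynomial.coeff_C_mul, Polynomial.coeff_sub,
            Polynomial.coeff_C_mul, abs_mul, ← abs_mul (x k)]
          exact mul_le_mul_of_nonneg_left (abs_sub _ _) (abs_nonneg _)
      _ = |u k| * (∑ i ∈ Finset.range M, |(Polynomial.X * q).coeff i| +
            |x k| * ∑ i ∈ Finset.range M, |q.coeff i|) := by
          rw [← Finset.mul_sum, Finset.sum_add_distrib, ← Finset.mul_sum]
      _ ≤ |u k| * (∏ k ∈ s, |u k| * (1 + |x k|) + |x k| * ∏ k ∈ s, |u k| * (1 + |x k|)) := by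
          gcongr
          exact ih M
      _ = |u k| * (1 + |x k|) * ∏ k ∈ s, |u k| * (1 + |x k|) := by ring

theorem Finset.prod_range_two_mul {M : Type*} [CommMonoid M] (f : ℕ → M) (n : ℕ) :
    ∏ j ∈ Finset.range (2 * n), f j = ∏ k ∈ Finset.range n, (f (2 * k) * f (2 * k + 1)) := by
  induction n with
  | zero => simp
  | succ n ih =>
    rw [Nat.mul_succ, Finset.prod_range_succ, Finset.prod_range_succ, ih, Finset.prod_range_succ,
      mul_assoc]

theorem Real.tendsto_euler_sinh_prod (t : ℝ) :
    Filter.Tendsto (fun n : ℕ => π * t * ∏ j ∈ Finset.range n, (1 + t ^ 2 / ((j : ℝ) + 1) ^ 2))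
      Filter.atTop (nhds (Real.sinh (π * t))) := by
  have h := Complex.tendsto_euler_sin_prod (t * Complex.I)
  rw [← mul_assoc, Complex.sin_mul_I] at h
  have h2 := (Complex.continuous_im.tendsto _).comp h
  rw [← Complex.ofReal_mul, ← Complex.ofReal_sinh, Complex.im_ofReal_mul, Complex.I_im, mul_one] at h2
  refine h2.congr fun n => ?_
  have e : (((π * t : ℝ) : ℂ) * Complex.I * ∏ j ∈ Finset.range n,
      (1 - (t * Complex.I) ^ 2 / ((j : ℂ) + 1) ^ 2)) =
      ((π * t * ∏ j ∈ Finset.range n, (1 + t ^ 2 / ((j : ℝ) + 1) ^ 2) : ℝ) : ℂ) * Complex.I := by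
    push_cast
    simp only [mul_pow, Complex.I_sq, mul_neg, mul_one, neg_div, sub_neg_eq_add]
    ring
  rw [Function.comp_apply, e, Complex.im_ofReal_mul, Complex.I_im, mul_one]

/-- Partial products of the Euler product of `cosh` are bounded by `cosh`. -/
theorem Real.euler_cosh_prod_le {a : ℝ} (ha : 0 < a) (N : ℕ) :
    ∏ k ∈ Finset.range N, (1 + (2 * a / (π * (2 * k + 1))) ^ 2) ≤ Real.cosh a := by
  set t : ℝ := a / π with ht
  have htpos : 0 < t := div_pos ha pi_pos
  have hat : a = π * t := by rw [ht]; field_simp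
  have hs : 0 < Real.sinh (π * t) := Real.sinh_pos_iff.2 (by positivity)
  have h1 := Real.tendsto_euler_sinh_prod t
  have h2 := (Real.tendsto_euler_sinh_prod (2 * t)).comp
    (Filter.tendsto_id.const_mul_atTop' (show 0 < 2 by norm_num))
  have h3 := h2.div (h1.const_mul 2) (by positivity)
  have hlim : Real.sinh (π * (2 * t)) / (2 * Real.sinh (π * t)) = Real.cosh a := by
    rw [show π * (2 * t) = 2 * (π * t) by ring, Real.sinh_two_mul, ← hat]
    rw [← hat] at hs
    field_simp
  rw [hlim] at h3
  have hmono : Monotone fun N : ℕ =>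
      ∏ k ∈ Finset.range N, (1 + (2 * a / (π * (2 * k + 1))) ^ 2) := by
    refine monotone_nat_of_le_succ fun n => ?_
    rw [Finset.prod_range_succ]
    refine le_mul_of_one_le_right (Finset.prod_nonneg fun _ _ => by positivity) ?_
    linarith [sq_nonneg (2 * a / (π * (2 * (n : ℝ) + 1)))]
  refine hmono.ge_of_tendsto (h3.congr fun n => ?_) N
  have hpos : 0 < ∏ j ∈ Finset.range n, (1 + t ^ 2 / ((j : ℝ) + 1) ^ 2) :=
    Finset.prod_pos fun _ _ => by positivity
  simp only [Function.comp, id, Pi.div_apply]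
  rw [div_eq_iff (by positivity), Finset.prod_range_two_mul, Finset.prod_mul_distrib]
  have e1 : ∀ k ∈ Finset.range n, 1 + (2 * t) ^ 2 / (((2 * k + 1 : ℕ) : ℝ) + 1) ^ 2 =
      1 + t ^ 2 / ((k : ℝ) + 1) ^ 2 := fun k _ => by
    push_cast; field_simp; ring
  have e2 : ∀ k ∈ Finset.range n, 1 + (2 * t) ^ 2 / (((2 * k : ℕ) : ℝ) + 1) ^ 2 =
      1 + (2 * a / (π * (2 * k + 1))) ^ 2 := fun k _ => by
    rw [hat]; push_cast; field_simp
  rw [Finset.prod_congr rfl e1, Finset.prod_congr rfl e2]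
  ring

theorem Nat.factorial_middle_mul_le (d m : ℕ) :
    (d + m)! * (d + m + 1)! ≤ d ! * (d + 2 * m + 1)! := by
  have h1 := Nat.choose_le_middle d (2 * (d + m) + 1)
  rw [show (2 * (d + m) + 1) / 2 = d + m by omega] at h1
  have h2 := Nat.choose_mul_factorial_mul_factorial (show d ≤ 2 * (d + m) + 1 by omega)
  have h3 := Nat.choose_mul_factorial_mul_factorial (show d + m ≤ 2 * (d + m) + 1 by omega)
  rw [show 2 * (d + m) + 1 - d = d + 2 * m + 1 by omega] at h2
  rw [show 2 * (d + m) + 1 - (d + m) = d + m + 1 by omega] at h3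
  have hpos : 0 < (2 * (d + m) + 1).choose d := Nat.choose_pos (by omega)
  refine Nat.le_of_mul_le_mul_left ?_ hpos
  calc (2 * (d + m) + 1).choose d * ((d + m)! * (d + m + 1)!)
      ≤ (2 * (d + m) + 1).choose (d + m) * ((d + m)! * (d + m + 1)!) := by gcongr
    _ = (2 * (d + m) + 1).choose d * (d ! * (d + 2 * m + 1)!) := by
      rw [← mul_assoc, h3, ← mul_assoc, h2]

theorem Real.pi_mul_prod_odd_sq_le (N : ℕ) :
    π * N * (∏ k ∈ Finset.range N, (2 * (k : ℝ) + 1)) ^ 2 ≤ 4 ^ N * (N ! : ℝ) ^ 2 := by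
  have hW := Real.Wallis.le_W N
  have hQ : 0 < ∏ k ∈ Finset.range N, (2 * (k : ℝ) + 1) := Finset.prod_pos fun _ _ => by positivity
  have e : Real.Wallis.W N * ((2 * N + 1) * (∏ k ∈ Finset.range N, (2 * (k : ℝ) + 1)) ^ 2) =
      4 ^ N * (N ! : ℝ) ^ 2 := by
    clear hW hQ
    induction N with
    | zero => simp [Real.Wallis.W]
    | succ N ih =>
      rw [Real.Wallis.W_succ, Finset.prod_range_succ, Nat.factorial_succ, pow_succ (4 : ℝ)]
      push_cast
      have : (4 : ℝ) ^ N * 4 * ((N + 1) * (N ! : ℝ)) ^ 2 =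
        4 ^ N * (N ! : ℝ) ^ 2 * (4 * (N + 1) ^ 2) := by ring
      rw [this, ← ih]
      field_simp
      ring
  rw [← e]
  set Q := ∏ k ∈ Finset.range N, (2 * (k : ℝ) + 1)
  refine le_trans ?_ (mul_le_mul_of_nonneg_right hW (by positivity))
  have h : (N : ℝ) ≤ (2 * N + 1) / (2 * N + 2) / 2 * (2 * N + 1) := by
    rw [div_div, div_mul_eq_mul_div, le_div_iff₀ (by positivity)]
    nlinarith
  calc π * N * Q ^ 2 = N * (π * Q ^ 2) := by ring
    _ ≤ (2 * N + 1) / (2 * N + 2) / 2 * (2 * N + 1) * (π * Q ^ 2) := by gcongr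
    _ = _ := by ring

theorem Finset.prod_erase_abs_odd_sq_sub (m d : ℕ) :
    (∏ k ∈ (Finset.range (m + 1 + d)).erase m,
      |(2 * (m : ℝ) + 1) ^ 2 - (2 * (k : ℝ) + 1) ^ 2|) * (2 * m + 1) =
      4 ^ (m + d) * (d ! : ℝ) * ((d + 2 * m + 1)! : ℝ) := by
  have hfac (k : ℕ) : (2 * (m : ℝ) + 1) ^ 2 - (2 * (k : ℝ) + 1) ^ 2 =
    4 * ((m - k) * (m + 1 + k)) := by ring
  induction d with
  | zero =>
    rw [add_zero, Finset.range_add_one, Finset.erase_insert (by simp)]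
    have h : ∀ k ∈ Finset.range m, |(2 * (m : ℝ) + 1) ^ 2 - (2 * (k : ℝ) + 1) ^ 2| =
        4 * (((m - k : ℕ) : ℝ) * ((m + 1 + k : ℕ) : ℝ)) := fun k hk => by
      have hk' := (Finset.mem_range.1 hk).le
      rw [hfac, ← Nat.cast_sub hk', abs_of_nonneg (by positivity)]
      push_cast
      rfl
    rw [Finset.prod_congr rfl h, Finset.prod_mul_distrib, Finset.prod_mul_distrib,
      ← Nat.cast_prod, ← Nat.cast_prod, ← Nat.ascFactorial_eq_prod_range]
    have e1 : ∏ k ∈ Finset.range m, (m - k) = m ! := by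
      rw [← Nat.descFactorial_eq_prod_range, Nat.descFactorial_self]
    have e2 : m ! * (m + 1).ascFactorial m = (2 * m)! := by
      rw [Nat.factorial_mul_ascFactorial, two_mul]
    rw [e1, ← Nat.cast_mul, e2, zero_add, Nat.factorial_succ]
    simp
    ring
  | succ d ih =>
    rw [← add_assoc, Finset.range_add_one, Finset.erase_insert_of_ne (by omega),
      Finset.prod_insert (by simp), mul_assoc, ih, hfac, abs_of_nonpos]
    · rw [show d + 1 + 2 * m + 1 = (d + 2 * m + 1) + 1 by ring, Nat.factorial_succ d,
        Nat.factorial_succ (d + 2 * m + 1)]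
      push_cast
      ring
    · push_cast
      have : (m : ℝ) - (m + 1 + d) ≤ 0 := by linarith [(Nat.cast_nonneg d : (0 : ℝ) ≤ d)]
      nlinarith [mul_nonneg (neg_nonneg.2 this) (by positivity : (0 : ℝ) ≤ m + 1 + (m + 1 + d))]

theorem Real.prod_erase_odd_sq_div_le {m N : ℕ} (hm : m < N) :
    ∏ k ∈ (Finset.range N).erase m,
      ((2 * (k : ℝ) + 1) ^ 2 / |(2 * (m : ℝ) + 1) ^ 2 - (2 * (k : ℝ) + 1) ^ 2|) ≤
      4 / (π * (2 * m + 1)) := by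
  obtain ⟨d, rfl⟩ := Nat.exists_eq_add_of_lt hm
  rw [show m + d + 1 = m + 1 + d by ring] at *
  have hD := Finset.prod_erase_abs_odd_sq_sub m d
  have hW := Real.pi_mul_prod_odd_sq_le (m + 1 + d)
  have hF : ((d + m)! : ℝ) * (d + m + 1)! ≤ d ! * (d + 2 * m + 1)! := by
    exact_mod_cast Nat.factorial_middle_mul_le d m
  rw [← Finset.mul_prod_erase _ _ (Finset.mem_range.2 hm)] at hW
  rw [Finset.prod_div_distrib, Finset.prod_pow]
  set Q := ∏ k ∈ (Finset.range (m + 1 + d)).erase m, (2 * (k : ℝ) + 1)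
  set D := ∏ k ∈ (Finset.range (m + 1 + d)).erase m,
    |(2 * (m : ℝ) + 1) ^ 2 - (2 * (k : ℝ) + 1) ^ 2|
  have hDpos : 0 < D := by
    refine pos_of_mul_pos_left ?_ (by positivity : (0 : ℝ) ≤ 2 * m + 1)
    rw [hD]
    positivity
  rw [div_le_div_iff₀ hDpos (by positivity)]
  have hW' : π * ((2 * m + 1) * Q) ^ 2 ≤
      4 ^ (m + 1 + d) * (((d + m)! : ℝ) * (d + m + 1)!) := by
    rw [show m + 1 + d = (d + m) + 1 by ring] at hW ⊢
    rw [Nat.factorial_succ] at hW ⊢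
    push_cast at hW ⊢
    have hp : (0 : ℝ) < d + m + 1 := by positivity
    refine le_of_mul_le_mul_left ?_ hp
    linarith
  have h := hW'.trans (mul_le_mul_of_nonneg_left hF (by positivity))
  have hm' : (0 : ℝ) < 2 * m + 1 := by positivity
  refine le_of_mul_le_mul_left ?_ hm'
  calc (2 * (m : ℝ) + 1) * (Q ^ 2 * (π * (2 * m + 1))) = π * ((2 * m + 1) * Q) ^ 2 := by ring
    _ ≤ _ := h
    _ = 4 * (4 ^ (m + d) * (d ! : ℝ) * ((d + 2 * m + 1)! : ℝ)) := by ring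
    _ = _ := by rw [← hD]; ring

/-- The `ℓ¹` bound for the Lagrange basis at the nodes `((2k+1)π/(2a))²`, in product form. -/
theorem Real.prod_erase_node_bound {a : ℝ} (ha : 0 < a) {m N : ℕ} (hm : m < N) :
    ∏ k ∈ (Finset.range N).erase m,
      (|(((2 * (m : ℝ) + 1) * π / (2 * a)) ^ 2 - ((2 * (k : ℝ) + 1) * π / (2 * a)) ^ 2)⁻¹| *
        (1 + |((2 * (k : ℝ) + 1) * π / (2 * a)) ^ 2|)) ≤ Real.exp a / a := by
  have e : ∀ k ∈ (Finset.range N).erase m,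
      |(((2 * (m : ℝ) + 1) * π / (2 * a)) ^ 2 - ((2 * (k : ℝ) + 1) * π / (2 * a)) ^ 2)⁻¹| *
        (1 + |((2 * (k : ℝ) + 1) * π / (2 * a)) ^ 2|) =
      (1 + (2 * a / (π * (2 * k + 1))) ^ 2) *
      ((2 * (k : ℝ) + 1) ^ 2 / |(2 * (m : ℝ) + 1) ^ 2 - (2 * (k : ℝ) + 1) ^ 2|) := fun k _ => by
    have h1 : ((2 * (m : ℝ) + 1) * π / (2 * a)) ^ 2 - ((2 * (k : ℝ) + 1) * π / (2 * a)) ^ 2 =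
        (π / (2 * a)) ^ 2 * ((2 * (m : ℝ) + 1) ^ 2 - (2 * (k : ℝ) + 1) ^ 2) := by ring
    rw [h1, abs_inv, abs_mul, abs_of_nonneg (sq_nonneg (π / (2 * a))),
      abs_of_nonneg (sq_nonneg ((2 * (k : ℝ) + 1) * π / (2 * a))),
      mul_inv, div_eq_mul_inv _ |_|]
    have h2 : ((π / (2 * a)) ^ 2)⁻¹ * (1 + ((2 * (k : ℝ) + 1) * π / (2 * a)) ^ 2) =
      (1 + (2 * a / (π * (2 * k + 1))) ^ 2) * (2 * (k : ℝ) + 1) ^ 2 := by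
      field_simp
      ring
    rw [← mul_assoc, ← h2]
    ring
  rw [Finset.prod_congr rfl e, Finset.prod_mul_distrib]
  have hC := Real.euler_cosh_prod_le ha N
  rw [← Finset.mul_prod_erase _ _ (Finset.mem_range.2 hm)] at hC
  have hP := Real.prod_erase_odd_sq_div_le hm
  set R := ∏ k ∈ (Finset.range N).erase m, (1 + (2 * a / (π * (2 * (k : ℝ) + 1))) ^ 2)
  have hR : 0 ≤ R := Finset.prod_nonneg fun _ _ => by positivity
  have hcosh : Real.cosh a ≤ Real.exp a := by
    rw [← Real.cosh_add_sinh]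
    linarith [Real.sinh_pos_iff.2 ha]
  have hc : (0 : ℝ) < 2 * m + 1 := by positivity
  set c : ℝ := 2 * m + 1
  refine (mul_le_mul_of_nonneg_left hP hR).trans ?_
  have key : 4 / (π * c) ≤ (1 + (2 * a / (π * c)) ^ 2) / a := by
    rw [le_div_iff₀ ha]
    have := sq_nonneg (1 - 2 * a / (π * c))
    have h4 : 4 / (π * c) * a = 2 * (2 * a / (π * c)) := by ring
    nlinarith
  calc R * (4 / (π * c)) ≤ R * ((1 + (2 * a / (π * c)) ^ 2) / a) := by gcongr
    _ = (1 + (2 * a / (π * c)) ^ 2) * R / a := by ring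
    _ ≤ Real.exp a / a := by gcongr; exact hC.trans hcosh

end

/-- collocation matrix bound, from the proof of Proposition 4.5:
for the `N×N` matrix `A_{nm} = (−1)^{n+m} ν̃_m^{2(n−1)}` with `ν̃_m = (2m−1)π/(2a)`
(indices `1 ≤ n,m ≤ N`, here realized on `Fin N`), `A` is invertible and the maximum
absolute row sum of `A⁻¹` is at most `e^a/a`. -/
theorem collocation_matrix_inverse_bound (N : ℕ) (hN : 1 ≤ N) (a : ℝ) (ha : 0 < a)
    (A : Matrix (Fin N) (Fin N) ℂ)
    (hA : ∀ n m : Fin N,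
      A n m = (-1 : ℂ) ^ ((n : ℕ) + (m : ℕ)) *
        (((2 * (m : ℕ) + 1) * π / (2 * a) : ℝ) : ℂ) ^ (2 * (n : ℕ))) :
    IsUnit A ∧ ∀ n : Fin N, ∑ m : Fin N, ‖A⁻¹ n m‖ ≤ Real.exp a / a := by
  set x : ℕ → ℝ := fun k => ((2 * (k : ℝ) + 1) * π / (2 * a)) ^ 2 with hx
  have hinj : Function.Injective x := by
    intro i j hij
    have h := (pow_left_inj₀ (by positivity) (by positivity) two_ne_zero).1 hij
    field_simp at h
    exact_mod_cast (by linarith : (i : ℝ) = j)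
  set L : ℕ → Polynomial ℝ := fun m => Lagrange.basis (Finset.range N) x m with hL
  set B : Matrix (Fin N) (Fin N) ℂ := Matrix.of fun m n =>
    (-1 : ℂ) ^ ((n : ℕ) + (m : ℕ)) * (((L m).coeff n : ℝ) : ℂ) with hB
  have hdeg (m : Fin N) : (L m).natDegree < N := by
    rw [hL, Lagrange.natDegree_basis hinj.injOn (Finset.mem_range.2 m.2), Finset.card_range]
    omega
  have hBA : B * A = 1 := by
    ext m k
    have hterm (n : Fin N) : B m n * A n k =
        (-1 : ℂ) ^ ((m : ℕ) + (k : ℕ)) * (((L m).coeff n * x k ^ (n : ℕ) : ℝ) : ℂ) := by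
      rw [hB, hA, Matrix.of_apply, hx, pow_mul]
      have hs : (-1 : ℂ) ^ ((n : ℕ) + (m : ℕ)) * (-1 : ℂ) ^ ((n : ℕ) + (k : ℕ)) =
          (-1 : ℂ) ^ ((m : ℕ) + (k : ℕ)) := by
        rw [← pow_add, show (n : ℕ) + m + (n + k) = 2 * n + (m + k) by ring, pow_add, pow_mul]
        simp
      rw [← hs]
      push_cast
      ring
    rw [Matrix.mul_apply, Finset.sum_congr rfl fun n _ => hterm n, ← Finset.mul_sum,
      ← Complex.ofReal_sum, Fin.sum_univ_eq_sum_range (fun n => (L m).coeff n * x k ^ n) N,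
      ← Polynomial.eval_eq_sum_range' (hdeg m)]
    rcases eq_or_ne m k with rfl | hmk
    · rw [hL, Lagrange.eval_basis_self hinj.injOn (Finset.mem_range.2 m.2), Matrix.one_apply_eq,
        ← two_mul, pow_mul]
      simp
    · rw [hL, Lagrange.eval_basis_of_ne (Fin.val_ne_of_ne hmk) (Finset.mem_range.2 k.2),
        Matrix.one_apply_ne hmk]
      simp
  refine ⟨IsUnit.of_mul_eq_one_right B hBA, fun m => ?_⟩
  rw [Matrix.inv_eq_left_inv hBA]
  calc ∑ n : Fin N, ‖B m n‖ = ∑ n : Fin N, |(L m).coeff n| := by simp [hB]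
    _ = ∑ n ∈ Finset.range N, |(L m).coeff n| :=
        Fin.sum_univ_eq_sum_range (fun n => |(L m).coeff n|) N
    _ ≤ _ := Polynomial.sum_abs_coeff_prod_linear_le _ (fun k => (x m - x k)⁻¹) x N
    _ ≤ Real.exp a / a := Real.prod_erase_node_bound ha m.2

end
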